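/- arXiv:2002.02679 — 2 statements merged into one kernel-verified Lean document; each statement's English description precedes it below -/
import Mathlib

section
/- For every real number z with |z| < e^{−1}, the series x(z) = 1 + Σ_{n=1}^∞ (−1)^{n−1}·((n−1)^{n−1}/n!)·z^n (with 0⁰ = 1) converges, its sum x(z) is positive, and it satisfies x(z)·log(x(z)) = z. -/
open Filter Topology

/-- The coefficient of `z ^ n` in `exp (a * W z)`, where `W` is the Lambert function:
`abelCoeff n a = a * (a - n) ^ (n - 1) / n!`. -/
noncomputable def abelCoeff : ℕ → ℝ → ℝ
  | 0, _ => 1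
  | n + 1, a => a * (a - (n + 1)) ^ n / (Nat.factorial (n + 1) : ℝ)

theorem hasDerivAt_abelCoeff_succ (n : ℕ) (a : ℝ) :
    HasDerivAt (abelCoeff (n + 1)) (abelCoeff n (a - 1)) a := by
  have h := (((hasDerivAt_id a).mul (((hasDerivAt_id a).sub_const ((n : ℝ) + 1)).pow n)).div_const
    (Nat.factorial (n + 1) : ℝ))
  refine (h.congr_deriv ?_).congr_of_eventuallyEq (Eventually.of_forall fun x => ?_)
  · cases n with
    | zero => simp [abelCoeff]
    | succ m =>
      have hf : (Nat.factorial (m + 1) : ℝ) ≠ 0 := by positivity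
      have hm : (m : ℝ) + 1 + 1 ≠ 0 := by positivity
      simp only [abelCoeff, Nat.factorial_succ (m + 1), id, Nat.add_sub_cancel, Pi.pow_apply]
      push_cast
      field_simp
      ring
  · simp [abelCoeff]

theorem abelCoeff_add (n : ℕ) (a b : ℝ) :
    abelCoeff n (a + b) =
      ∑ p ∈ Finset.HasAntidiagonal.antidiagonal n, abelCoeff p.1 a * abelCoeff p.2 b := by
  induction n generalizing a with
  | zero => simp [abelCoeff]
  | succ n ih =>
    simp only [Finset.Nat.sum_antidiagonal_succ]
    have hderiv (t : ℝ) : HasDerivAt (fun t => abelCoeff (n + 1) (t + b) -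
        (abelCoeff 0 t * abelCoeff (n + 1) b +
          ∑ p ∈ Finset.HasAntidiagonal.antidiagonal n, abelCoeff (p.1 + 1) t * abelCoeff p.2 b)) 0 t := by
      have hl := (hasDerivAt_abelCoeff_succ n (t + b)).comp_add_const t b
      have hr := HasDerivAt.fun_sum (u := Finset.HasAntidiagonal.antidiagonal n) fun p _ =>
        (hasDerivAt_abelCoeff_succ p.1 t).mul_const (abelCoeff p.2 b)
      refine (hl.sub (hr.const_add (abelCoeff (n + 1) b))).congr_deriv ?_ |>.congr_of_eventuallyEq
        (Eventually.of_forall fun x => by simp [abelCoeff])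
      rw [← ih, sub_eq_zero]
      ring_nf
    have hconst := is_const_of_deriv_eq_zero (fun t => (hderiv t).differentiableAt)
      (fun t => (hderiv t).deriv) a 0
    have hzero : abelCoeff (n + 1) (0 + b) - (abelCoeff 0 0 * abelCoeff (n + 1) b +
        ∑ p ∈ Finset.HasAntidiagonal.antidiagonal n, abelCoeff (p.1 + 1) 0 * abelCoeff p.2 b) = 0 := by
      simp [abelCoeff]
    exact sub_eq_zero.mp (hconst.trans hzero)

theorem abs_sub_pow_div_factorial_le {a : ℝ} (ha : |a| ≤ 1) (n : ℕ) :
    |(a - (n + 1)) ^ n / (Nat.factorial (n + 1) : ℝ)| ≤ Real.exp 1 ^ (n + 2) := by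
  have hbase : |a - (n + 1)| ≤ n + 2 := by
    rw [abs_le] at ha ⊢
    constructor <;> linarith [(Nat.cast_nonneg n : (0 : ℝ) ≤ n), ha.1, ha.2]
  have hf : (0 : ℝ) < Nat.factorial (n + 1) := by positivity
  calc |(a - (n + 1)) ^ n / (Nat.factorial (n + 1) : ℝ)|
      = |a - (n + 1)| ^ n / Nat.factorial (n + 1) := by
        rw [abs_div, abs_pow, abs_of_pos hf]
    _ ≤ (n + 2 : ℝ) ^ n / Nat.factorial (n + 1) := by gcongr
    _ ≤ (n + 2 : ℝ) ^ (n + 1) / Nat.factorial (n + 1) := by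
        gcongr
        · linarith [(Nat.cast_nonneg n : (0 : ℝ) ≤ n)]
        · omega
    _ ≤ Real.exp (n + 2) := Real.pow_div_factorial_le_exp _ (by positivity) _
    _ = Real.exp 1 ^ (n + 2) := by rw [← Real.exp_nat_mul]; push_cast; ring_nf

/-- The series `∑ (a - (n + 1)) ^ n / (n + 1)! * z ^ (n + 1)`, equal to
`(exp (a * W z) - 1) / a` for `a ≠ 0` and to the Lambert function `W z` for `a = 0`. -/
noncomputable def abelSlopeTerm (z a : ℝ) (n : ℕ) : ℝ :=
  (a - (n + 1)) ^ n / (Nat.factorial (n + 1) : ℝ) * z ^ (n + 1)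

section

variable {z : ℝ}

theorem norm_abelSlopeTerm_le {a : ℝ} (ha : |a| ≤ 1) (n : ℕ) :
    ‖abelSlopeTerm z a n‖ ≤ Real.exp 1 * (Real.exp 1 * |z|) ^ (n + 1) := by
  rw [abelSlopeTerm, Real.norm_eq_abs, abs_mul, abs_pow]
  calc _ ≤ Real.exp 1 ^ (n + 2) * |z| ^ (n + 1) := by
        gcongr
        exact abs_sub_pow_div_factorial_le ha n
    _ = _ := by ring

theorem summable_exp_mul_abs_pow (hz : |z| < Real.exp (-1)) :
    Summable fun n : ℕ => Real.exp 1 * (Real.exp 1 * |z|) ^ (n + 1) := by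
  have hlt : Real.exp 1 * |z| < 1 := by
    calc _ < Real.exp 1 * Real.exp (-1) := by gcongr
      _ = 1 := by rw [← Real.exp_add]; simp
  exact ((summable_nat_add_iff 1).mpr
    (summable_geometric_of_lt_one (by positivity) hlt)).mul_left _

theorem summable_norm_abelSlopeTerm (hz : |z| < Real.exp (-1)) {a : ℝ} (ha : |a| ≤ 1) :
    Summable fun n => ‖abelSlopeTerm z a n‖ :=
  (summable_exp_mul_abs_pow hz).of_nonneg_of_le (fun _ => norm_nonneg _) (norm_abelSlopeTerm_le ha)

theorem abelCoeff_succ_mul_pow (a : ℝ) (n : ℕ) :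
    abelCoeff (n + 1) a * z ^ (n + 1) = a * abelSlopeTerm z a n := by
  simp only [abelCoeff, abelSlopeTerm]
  ring

theorem summable_norm_abelCoeff (hz : |z| < Real.exp (-1)) {a : ℝ} (ha : |a| ≤ 1) :
    Summable fun n => ‖abelCoeff n a * z ^ n‖ := by
  rw [← summable_nat_add_iff 1]
  simp only [abelCoeff_succ_mul_pow, norm_mul]
  exact (summable_norm_abelSlopeTerm hz ha).mul_left _

theorem tsum_abelCoeff (hz : |z| < Real.exp (-1)) {a : ℝ} (ha : |a| ≤ 1) :
    ∑' n, abelCoeff n a * z ^ n = 1 + a * ∑' n, abelSlopeTerm z a n := by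
  rw [(summable_norm_abelCoeff hz ha).of_norm.tsum_eq_zero_add]
  simp only [abelCoeff_succ_mul_pow, tsum_mul_left]
  simp [abelCoeff]

theorem tsum_abelCoeff_add (hz : |z| < Real.exp (-1)) {a b : ℝ} (ha : |a| ≤ 1) (hb : |b| ≤ 1) :
    ∑' n, abelCoeff n (a + b) * z ^ n =
      (∑' n, abelCoeff n a * z ^ n) * ∑' n, abelCoeff n b * z ^ n := by
  rw [tsum_mul_tsum_eq_tsum_sum_antidiagonal_of_summable_norm
    (summable_norm_abelCoeff hz ha) (summable_norm_abelCoeff hz hb)]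
  refine tsum_congr fun n => ?_
  rw [abelCoeff_add, Finset.sum_mul]
  refine Finset.sum_congr rfl fun p hp => ?_
  rw [← Finset.HasAntidiagonal.mem_antidiagonal.mp hp, pow_add]
  ring

theorem tsum_abelCoeff_nat_mul (hz : |z| < Real.exp (-1)) {a : ℝ} (ha : 0 ≤ a) (k : ℕ)
    (hk : k * a ≤ 1) :
    ∑' n, abelCoeff n (k * a) * z ^ n = (∑' n, abelCoeff n a * z ^ n) ^ k := by
  induction k with
  | zero => rw [Nat.cast_zero, zero_mul, tsum_abelCoeff hz (by simp)]; simp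
  | succ k ih =>
    push_cast at hk ⊢
    have hka : 0 ≤ k * a := by positivity
    have h₁ : |k * a| ≤ 1 := by rw [abs_of_nonneg hka]; linarith
    have h₂ : |a| ≤ 1 := by rw [abs_of_nonneg ha]; linarith
    rw [add_mul, one_mul, tsum_abelCoeff_add hz h₁ h₂, ih (by linarith), pow_succ]

theorem tendsto_tsum_abelSlopeTerm (hz : |z| < Real.exp (-1)) :
    Tendsto (fun N : ℕ => ∑' n, abelSlopeTerm z (N : ℝ)⁻¹ n) atTop
      (𝓝 (∑' n, abelSlopeTerm z 0 n)) := by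
  refine tendsto_tsum_of_dominated_convergence (summable_exp_mul_abs_pow hz) (fun n => ?_)
    (Eventually.of_forall fun N n => norm_abelSlopeTerm_le ?_ n)
  · have hc : Continuous fun a => abelSlopeTerm z a n := by unfold abelSlopeTerm; fun_prop
    exact (hc.tendsto 0).comp tendsto_inv_atTop_nhds_zero_nat
  · rw [abs_of_nonneg (by positivity)]
    exact Nat.cast_inv_le_one N

theorem tsum_abelCoeff_one_eq_exp (hz : |z| < Real.exp (-1)) :
    ∑' n, abelCoeff n 1 * z ^ n = Real.exp (∑' n, abelSlopeTerm z 0 n) := by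
  have hlim : Tendsto (fun N : ℕ => (1 + (N : ℝ)⁻¹ * ∑' n, abelSlopeTerm z (N : ℝ)⁻¹ n) ^ N) atTop
      (𝓝 (Real.exp (∑' n, abelSlopeTerm z 0 n))) := by
    refine Real.tendsto_one_add_pow_exp_of_tendsto ?_
    refine (tendsto_tsum_abelSlopeTerm hz).congr' ?_
    filter_upwards [eventually_ne_atTop 0] with N hN
    field_simp
  refine tendsto_nhds_unique (tendsto_const_nhds.congr' ?_) hlim
  filter_upwards [eventually_ne_atTop 0] with N hN
  have hmul : (N : ℝ) * (N : ℝ)⁻¹ = 1 := mul_inv_cancel₀ (Nat.cast_ne_zero.mpr hN)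
  have habs : |(N : ℝ)⁻¹| ≤ 1 := by
    rw [abs_of_nonneg (by positivity)]
    exact Nat.cast_inv_le_one N
  rw [← tsum_abelCoeff hz habs, ← tsum_abelCoeff_nat_mul hz (by positivity) N hmul.le, hmul]

theorem abelSlopeTerm_zero (n : ℕ) :
    abelSlopeTerm z 0 n = z * (abelCoeff n (-1) * z ^ n) := by
  cases n with
  | zero => simp [abelSlopeTerm, abelCoeff]
  | succ m =>
    have hf : (Nat.factorial (m + 1) : ℝ) ≠ 0 := by positivity
    have hm : (m : ℝ) + 1 + 1 ≠ 0 := by positivity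
    simp only [abelSlopeTerm, abelCoeff, Nat.factorial_succ (m + 1)]
    push_cast
    field_simp
    ring

theorem tsum_abelCoeff_one_mul_tsum_abelSlopeTerm_zero (hz : |z| < Real.exp (-1)) :
    (∑' n, abelCoeff n 1 * z ^ n) * ∑' n, abelSlopeTerm z 0 n = z := by
  simp only [abelSlopeTerm_zero, tsum_mul_left]
  rw [mul_left_comm, ← tsum_abelCoeff_add hz (by simp) (by simp), add_neg_cancel,
    tsum_abelCoeff hz (by simp)]
  simp

end

/-- For `|z| < e⁻¹` the Lagrange inversion series
`x(z) = 1 + Σ_{n≥1} (-1)^{n-1}((n-1)^{n-1}/n!)z^n` converges, its sum is positive,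
and it solves `x·log x = z`. -/
theorem carlini_xx_series (z : ℝ) (hz : |z| < Real.exp (-1)) :
    Summable (fun n : ℕ =>
      (-1 : ℝ) ^ n * (n : ℝ) ^ n * z ^ (n + 1) / (Nat.factorial (n + 1) : ℝ)) ∧
    0 < 1 + ∑' n : ℕ,
      (-1 : ℝ) ^ n * (n : ℝ) ^ n * z ^ (n + 1) / (Nat.factorial (n + 1) : ℝ) ∧
    (1 + ∑' n : ℕ,
        (-1 : ℝ) ^ n * (n : ℝ) ^ n * z ^ (n + 1) / (Nat.factorial (n + 1) : ℝ)) *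
      Real.log (1 + ∑' n : ℕ,
        (-1 : ℝ) ^ n * (n : ℝ) ^ n * z ^ (n + 1) / (Nat.factorial (n + 1) : ℝ)) = z := by
  have hterm : (fun n : ℕ =>
      (-1 : ℝ) ^ n * (n : ℝ) ^ n * z ^ (n + 1) / (Nat.factorial (n + 1) : ℝ)) =
      abelSlopeTerm z 1 := by
    funext n
    rw [abelSlopeTerm, ← mul_pow]
    ring
  have hexp := tsum_abelCoeff_one_eq_exp hz
  have hmul := tsum_abelCoeff_one_mul_tsum_abelSlopeTerm_zero hz
  rw [tsum_abelCoeff hz (by simp), one_mul] at hexp hmul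
  rw [hterm]
  refine ⟨(summable_norm_abelSlopeTerm hz (by simp)).of_norm, ?_, ?_⟩
  · rw [hexp]
    exact Real.exp_pos _
  · rwa [hexp, Real.log_exp, ← hexp]
end

section
/- Let c ∈ [0,1) and let θ : ℝ → ℝ assign to each u the unique real solution of θ(u) − c·sin θ(u) = u. Then for every real u, the series Σ_{n=1}^∞ (2/(n·π))·(∫_0^π cos(n·t − n·c·sin t) dt)·sin(n·u) converges and its sum equals θ(u) − u. -/
open Real in
/-- The integral `π · J_a(a c)` in Bessel's form. -/
noncomputable def besselIntegral (c a : ℝ) : ℝ :=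
  ∫ t in (0 : ℝ)..π, cos (a * t - a * c * sin t)

lemma besselIntegral_neg (c a : ℝ) : besselIntegral c (-a) = besselIntegral c a := by
  unfold besselIntegral
  congr 1 with t
  rw [← Real.cos_neg]
  ring_nf

lemma one_sub_le_one_sub_mul_cos {c : ℝ} (hc0 : 0 ≤ c) (t : ℝ) :
    1 - c ≤ 1 - c * Real.cos t := by
  nlinarith [Real.cos_le_one t]

lemma hasDerivAt_sub_mul_sin (c t : ℝ) :
    HasDerivAt (fun t ↦ t - c * Real.sin t) (1 - c * Real.cos t) t :=
  (hasDerivAt_id t).sub ((Real.hasDerivAt_sin t).const_mul c)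

open Real in
/-- Integration by parts gives the decay `O(1/n)` of the Bessel integrals. -/
lemma abs_besselIntegral_le {c : ℝ} (hc0 : 0 ≤ c) (hc1 : c < 1) {n : ℕ} (hn : n ≠ 0) :
    |besselIntegral c n| ≤ c / (1 - c) ^ 2 * π / n := by
  have hn' : (0 : ℝ) < n := by positivity
  have hpos (t : ℝ) : 0 < 1 - c * cos t := by linarith [one_sub_le_one_sub_mul_cos hc0 t]
  have hu (t : ℝ) : HasDerivAt (fun t ↦ (1 - c * cos t)⁻¹)
      (-(c * sin t) / (1 - c * cos t) ^ 2) t := by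
    have h := (((hasDerivAt_cos t).const_mul c).const_sub 1).inv (hpos t).ne'
    convert! h using 1
    ring
  have hv (t : ℝ) : HasDerivAt (fun t ↦ sin (n * (t - c * sin t)) / n)
      (cos (n * (t - c * sin t)) * (1 - c * cos t)) t := by
    have h := (((hasDerivAt_sub_mul_sin c t).const_mul (n : ℝ)).sin).div_const (n : ℝ)
    convert! h using 1
    field_simp
  have hu'c : Continuous fun t ↦ -(c * sin t) / (1 - c * cos t) ^ 2 := by
    refine Continuous.div (by fun_prop) (by fun_prop) fun t ↦ ?_
    exact pow_ne_zero _ (hpos t).ne'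
  have hv'c : Continuous fun t ↦ cos (n * (t - c * sin t)) * (1 - c * cos t) := by fun_prop
  have key := intervalIntegral.integral_mul_deriv_eq_deriv_mul (a := 0) (b := π)
    (fun t _ ↦ hu t) (fun t _ ↦ hv t) (hu'c.intervalIntegrable _ _) (hv'c.intervalIntegrable _ _)
  have hI : besselIntegral c n =
      ∫ t in (0 : ℝ)..π, (1 - c * cos t)⁻¹ * (cos (n * (t - c * sin t)) * (1 - c * cos t)) := by
    unfold besselIntegral
    congr 1 with t
    rw [mul_comm (cos _), inv_mul_cancel_left₀ (hpos t).ne']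
    ring_nf
  rw [hI, key]
  simp only [sin_pi, sin_zero, mul_zero, sub_zero, sin_nat_mul_pi, zero_div, zero_sub, abs_neg]
  have hb := intervalIntegral.norm_integral_le_of_norm_le_const (a := 0) (b := π)
    (C := c / (1 - c) ^ 2 / n)
    (f := fun t ↦ -(c * sin t) / (1 - c * cos t) ^ 2 * (sin (n * (t - c * sin t)) / n))
    fun t _ ↦ by
      have h1 : (0 : ℝ) < 1 - c := by linarith
      have h2 := one_sub_le_one_sub_mul_cos hc0 t
      rw [norm_mul, norm_div, norm_div, norm_neg, norm_mul, norm_pow]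
      simp only [Real.norm_eq_abs, abs_of_nonneg hc0, abs_of_pos (hpos t), abs_of_pos hn']
      calc c * |sin t| / (1 - c * cos t) ^ 2 * (|sin (n * (t - c * sin t))| / n)
          ≤ c * 1 / (1 - c) ^ 2 * (1 / n) := by
            gcongr
            · exact abs_sin_le_one _
            · exact abs_sin_le_one _
        _ = c / (1 - c) ^ 2 / n := by ring
  rw [Real.norm_eq_abs, sub_zero, abs_of_pos pi_pos] at hb
  exact hb.trans_eq (by ring)

open Complex in
lemma integral_exp_eq_two_mul_besselIntegral (c a : ℝ) :
    ∫ t in (-Real.pi)..Real.pi, exp (-I * a * (t - c * Real.sin t : ℝ)) =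
      2 * besselIntegral c a := by
  have hcont : Continuous fun t : ℝ ↦ exp (-I * a * (t - c * Real.sin t : ℝ)) := by fun_prop
  have hcont' : Continuous fun t : ℝ ↦ exp (-I * a * (-t - c * Real.sin (-t) : ℝ)) := by fun_prop
  rw [← intervalIntegral.integral_add_adjacent_intervals (hcont.intervalIntegrable _ 0)
    (hcont.intervalIntegrable _ _)]
  have h := intervalIntegral.integral_comp_neg (a := 0) (b := Real.pi)
    (fun t : ℝ ↦ exp (-I * a * (t - c * Real.sin t : ℝ)))
  rw [neg_zero] at h
  rw [← h, ← intervalIntegral.integral_add (hcont'.intervalIntegrable _ _)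
    (hcont.intervalIntegrable _ _), besselIntegral, ← intervalIntegral.integral_ofReal,
    ← intervalIntegral.integral_const_mul]
  congr 1 with t
  rw [ofReal_cos, two_cos]
  congr 2 <;> push_cast [Real.sin_neg] <;> ring

open Complex in
lemma integral_mul_sin_mul_exp (c : ℝ) {n : ℤ} (hn : n ≠ 0) :
    ∫ t in (-Real.pi)..Real.pi, (c * Real.sin t * (1 - c * Real.cos t) : ℝ) *
      exp (-I * n * (t - c * Real.sin t : ℝ)) = 2 * besselIntegral c n / (I * n) := by
  have hn' : (n : ℂ) ≠ 0 := by exact_mod_cast hn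
  have hE (t : ℝ) : HasDerivAt (fun t : ℝ ↦ exp (-I * n * (t - c * Real.sin t : ℝ)))
      (exp (-I * n * (t - c * Real.sin t : ℝ)) * (-I * n * (1 - c * Real.cos t : ℝ))) t :=
    (((hasDerivAt_sub_mul_sin c t).ofReal_comp).const_mul (-I * n)).cexp
  have hF (t : ℝ) : HasDerivAt
      (fun t : ℝ ↦ (I / n * (c * Real.sin t : ℝ) - 1 / n ^ 2) *
        exp (-I * n * (t - c * Real.sin t : ℝ)))
      (I / n * exp (-I * n * (t - c * Real.sin t : ℝ)) +
        (c * Real.sin t * (1 - c * Real.cos t) : ℝ) *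
          exp (-I * n * (t - c * Real.sin t : ℝ))) t := by
    have h := (((((Real.hasDerivAt_sin t).const_mul c).ofReal_comp).const_mul
      (I / n)).sub_const (1 / n ^ 2 : ℂ)).mul (hE t)
    convert! h using 1
    generalize exp _ = E
    push_cast
    field_simp
    linear_combination (n * E * c * sin t * (1 - c * cos t)) * I_sq
  have hc1 : Continuous fun t : ℝ ↦ I / n * exp (-I * n * (t - c * Real.sin t : ℝ)) := by
    fun_prop
  have hc2 : Continuous fun t : ℝ ↦ (c * Real.sin t * (1 - c * Real.cos t) : ℝ) *
      exp (-I * n * (t - c * Real.sin t : ℝ)) := by fun_prop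
  have key := intervalIntegral.integral_eq_sub_of_hasDerivAt (a := -Real.pi) (b := Real.pi)
    (fun t _ ↦ hF t) ((hc1.add hc2).intervalIntegrable _ _)
  rw [intervalIntegral.integral_add (hc1.intervalIntegrable _ _) (hc2.intervalIntegrable _ _),
    intervalIntegral.integral_const_mul] at key
  have hA := integral_exp_eq_two_mul_besselIntegral c n
  rw [ofReal_intCast] at hA
  have hper : exp (-I * n * (Real.pi : ℝ)) = exp (-I * n * (-Real.pi : ℝ)) := by
    rw [exp_eq_exp_iff_exists_int]
    exact ⟨-n, by push_cast; ring⟩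
  simp only [Real.sin_neg, Real.sin_pi, neg_zero, mul_zero, sub_zero] at key
  rw [hA, hper, sub_self] at key
  rw [eq_neg_of_add_eq_zero_right key]
  field_simp
  rw [I_sq]
  ring

lemma integral_mul_sin_mul_one_sub (c : ℝ) :
    ∫ t in (-Real.pi)..Real.pi, c * Real.sin t * (1 - c * Real.cos t) = 0 := by
  have hF (t : ℝ) : HasDerivAt (fun t ↦ (1 - c * Real.cos t) ^ 2 / 2)
      (c * Real.sin t * (1 - c * Real.cos t)) t := by
    have h := ((((Real.hasDerivAt_cos t).const_mul c).const_sub 1).pow 2).div_const 2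
    convert! h using 1
    ring
  rw [intervalIntegral.integral_eq_sub_of_hasDerivAt (fun t _ ↦ hF t)
    (Continuous.intervalIntegrable (by fun_prop) _ _)]
  simp

section EccentricAnomaly

variable {c : ℝ} {θ : ℝ → ℝ}

lemma mul_abs_sub_le_of_kepler (hc0 : 0 ≤ c) (x y : ℝ) :
    (1 - c) * |x - y| ≤ |(x - c * Real.sin x) - (y - c * Real.sin y)| := by
  have h1 := mul_le_mul_of_nonneg_left (Real.abs_sin_sub_sin_le x y) hc0
  have h2 := abs_sub_abs_le_abs_sub (x - y) (c * (Real.sin x - Real.sin y))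
  rw [abs_mul, abs_of_nonneg hc0] at h2
  rw [show (x - c * Real.sin x) - (y - c * Real.sin y) =
    (x - y) - c * (Real.sin x - Real.sin y) by ring]
  linarith

lemma kepler_unique (hc0 : 0 ≤ c) (hc1 : c < 1) {x y : ℝ}
    (h : x - c * Real.sin x = y - c * Real.sin y) : x = y := by
  have h1 := mul_abs_sub_le_of_kepler hc0 x y
  rw [h, sub_self, abs_zero] at h1
  have h2 : |x - y| ≤ 0 := by
    by_contra! h3
    nlinarith
  exact sub_eq_zero.mp (abs_nonpos_iff.mp h2)

lemma continuous_eccentricAnomaly (hc0 : 0 ≤ c) (hc1 : c < 1)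
    (hθ : ∀ u, θ u - c * Real.sin (θ u) = u) : Continuous θ := by
  refine (LipschitzWith.of_dist_le_mul (K := (1 - c)⁻¹.toNNReal) fun u v ↦ ?_).continuous
  have hpos : 0 < 1 - c := by linarith
  have h := mul_abs_sub_le_of_kepler hc0 (θ u) (θ v)
  rw [hθ, hθ] at h
  rw [Real.coe_toNNReal _ (by positivity), Real.dist_eq, Real.dist_eq, inv_mul_eq_div,
    le_div_iff₀ hpos]
  linarith

lemma periodic_eccentricAnomaly_sub (hc0 : 0 ≤ c) (hc1 : c < 1)
    (hθ : ∀ u, θ u - c * Real.sin (θ u) = u) :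
    Function.Periodic (fun u ↦ ((θ u - u : ℝ) : ℂ)) (2 * Real.pi) := by
  intro u
  have h : θ (u + 2 * Real.pi) = θ u + 2 * Real.pi := by
    apply kepler_unique hc0 hc1
    rw [hθ, Real.sin_add_two_pi]
    linarith [hθ u]
  simp only [h]
  congr 1
  ring

open Complex in
/-- The change of variables `u = t - c sin t`. -/
lemma integral_eccentricAnomaly (hc0 : 0 ≤ c) (hc1 : c < 1)
    (hθ : ∀ u, θ u - c * Real.sin (θ u) = u) (n : ℤ) :
    ∫ u in (-Real.pi)..Real.pi, exp (-I * n * u) * ((θ u - u : ℝ) : ℂ) =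
      ∫ t in (-Real.pi)..Real.pi, (c * Real.sin t * (1 - c * Real.cos t) : ℝ) *
        exp (-I * n * (t - c * Real.sin t : ℝ)) := by
  have hcont := continuous_eccentricAnomaly hc0 hc1 hθ
  have h := intervalIntegral.integral_deriv_smul_comp (a := -Real.pi) (b := Real.pi)
    (g := fun u : ℝ ↦ exp (-I * n * u) * ((θ u - u : ℝ) : ℂ))
    (fun t _ ↦ hasDerivAt_sub_mul_sin c t) (by fun_prop) (by fun_prop)
  simp only [Real.sin_neg, Real.sin_pi, neg_zero, mul_zero, sub_zero] at h
  rw [← h]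
  congr 1 with t
  have ht : θ (t - c * Real.sin t) = t := kepler_unique hc0 hc1 (hθ _)
  simp only [Function.comp_apply, ht, real_smul]
  push_cast
  ring

end EccentricAnomaly

open Complex in
/-- Bessel's solution of Kepler's equation: for every `u`, the sine series
`Σ_{n≥1} (2/(nπ))·(∫_0^π cos(nt - nc·sin t) dt)·sin(nu)` converges to `θ(u) - u`
(indices shifted so `n` corresponds to `n+1`). -/
theorem bessel_kepler_series (c : ℝ) (hc0 : 0 ≤ c) (hc1 : c < 1)
    (θ : ℝ → ℝ) (hθ : ∀ u : ℝ, θ u - c * Real.sin (θ u) = u) :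
    ∀ u : ℝ,
      HasSum
        (fun n : ℕ =>
          (2 / (((n : ℝ) + 1) * Real.pi)) *
            (∫ t in (0 : ℝ)..Real.pi,
              Real.cos (((n : ℝ) + 1) * t - ((n : ℝ) + 1) * c * Real.sin t)) *
            Real.sin (((n : ℝ) + 1) * u))
        (θ u - u) := by
  intro u
  have : Fact (0 < 2 * Real.pi) := ⟨Real.two_pi_pos⟩
  have hpi : (Real.pi : ℂ) ≠ 0 := by exact_mod_cast Real.pi_ne_zero
  have hper := periodic_eccentricAnomaly_sub hc0 hc1 hθ
  have hcont := continuous_eccentricAnomaly hc0 hc1 hθ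
  let f : C(AddCircle (2 * Real.pi), ℂ) :=
    ⟨hper.lift, continuous_coinduced_dom.mpr (by
      change Continuous fun u ↦ ((θ u - u : ℝ) : ℂ)
      fun_prop)⟩
  have hf (x : ℝ) : f (x : AddCircle (2 * Real.pi)) = ((θ x - x : ℝ) : ℂ) := rfl
  have hfourier (n : ℤ) (x : ℝ) :
      fourier n (x : AddCircle (2 * Real.pi)) = exp (I * n * x) := by
    rw [fourier_coe_apply]
    congr 1
    push_cast
    field_simp
  have hcoeff (n : ℤ) : fourierCoeff f n = 1 / (2 * Real.pi) *
      ∫ t in (-Real.pi)..Real.pi, (c * Real.sin t * (1 - c * Real.cos t) : ℝ) *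
        exp (-I * n * (t - c * Real.sin t : ℝ)) := by
    rw [fourierCoeff_eq_intervalIntegral _ n (-Real.pi),
      show -Real.pi + 2 * Real.pi = Real.pi by ring, ← integral_eccentricAnomaly hc0 hc1 hθ]
    simp only [hf, hfourier, real_smul, smul_eq_mul]
    push_cast
    simp only [mul_neg, neg_mul]
  have hcoeff0 : fourierCoeff f 0 = 0 := by
    rw [hcoeff]
    simp only [Int.cast_zero, mul_zero, zero_mul, exp_zero, mul_one]
    rw [intervalIntegral.integral_ofReal, integral_mul_sin_mul_one_sub, ofReal_zero, mul_zero]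
  have hcoeff' {n : ℤ} (hn : n ≠ 0) :
      fourierCoeff f n = besselIntegral c n / (Real.pi * I * n) := by
    have hn' : (n : ℂ) ≠ 0 := by exact_mod_cast hn
    rw [hcoeff, integral_mul_sin_mul_exp c hn]
    field_simp
  have hbound (n : ℤ) : ‖fourierCoeff f n‖ ≤ c / (1 - c) ^ 2 * (1 / (n : ℝ) ^ 2) := by
    rcases eq_or_ne n 0 with rfl | hn
    · simp [hcoeff0]
    have hJ : |besselIntegral c n| ≤ c / (1 - c) ^ 2 * Real.pi / |(n : ℝ)| := by
      have h := abs_besselIntegral_le hc0 hc1 (Int.natAbs_ne_zero.mpr hn)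
      rw [Nat.cast_natAbs, Int.cast_abs] at h
      rcases abs_choice (n : ℝ) with h' | h'
      · rwa [h'] at h ⊢
      · rw [h', besselIntegral_neg] at h
        rwa [h']
    have hn0 : 0 < |(n : ℝ)| := by positivity
    rw [hcoeff' hn, norm_div, norm_mul, norm_mul, norm_I, norm_real, norm_real, norm_intCast,
      Real.norm_eq_abs, Real.norm_eq_abs, abs_of_pos Real.pi_pos, mul_one,
      div_le_iff₀ (by positivity)]
    refine hJ.trans_eq ?_
    rw [← sq_abs (n : ℝ)]
    field_simp
  have hsummable : Summable (fourierCoeff f) :=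
    .of_norm_bounded ((Real.summable_one_div_int_pow.mpr one_lt_two).mul_left _) hbound
  have hsum := (has_pointwise_sum_fourier_series_of_summable hsummable
    (u : AddCircle (2 * Real.pi))).nat_add_neg
  rw [← hasSum_nat_add_iff' 1] at hsum
  rw [← hasSum_ofReal]
  convert! hsum using 1
  · ext n
    have hn : ((n + 1 : ℕ) : ℤ) ≠ 0 := by positivity
    have hn' : (n : ℂ) + 1 ≠ 0 := by exact_mod_cast n.succ_ne_zero
    have hJ : ∫ t in (0 : ℝ)..Real.pi,
        Real.cos (((n : ℝ) + 1) * t - ((n : ℝ) + 1) * c * Real.sin t) =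
        besselIntegral c (n + 1) := rfl
    rw [hJ, hcoeff' hn, hcoeff' (neg_ne_zero.mpr hn), hfourier, hfourier]
    push_cast
    rw [besselIntegral_neg, sin]
    rw [show I * (n + 1 : ℂ) * u = (n + 1) * u * I by ring,
      show I * -(n + 1 : ℂ) * u = -((n + 1) * u) * I by ring]
    generalize exp _ = A
    generalize exp _ = B
    simp only [smul_eq_mul]
    field_simp
    linear_combination (besselIntegral c (n + 1) * (A - B)) * I_sq
  · simp [hf, hcoeff0]
end
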